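/- Let N > 1 be a natural number, let a < b be real numbers, and let x : Fin N → ℝ satisfy a ≤ x j ≤ b for all j, with mean μ = (1/N)·∑_{j} x j. Model a sample of size m drawn without replacement by choosing a permutation σ of Fin N uniformly at random and forming the sample mean X̄_m = (1/m)·∑_{t=0}^{m-1} x (σ t). Fix ε ∈ (0,1) and δ ∈ (0,1), and set u = (log(1/δ)/2)·(b − a)²/ε². Then for every natural number m with 1 ≤ m ≤ N and m ≥ min{(u + 1)/(1 + u/N), (u + u/N)/(1 + u/N)}, the probability of the event X̄_m − μ ≤ ε is at least 1 − δ. -/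

import Mathlib

open MeasureTheory ProbabilityTheory in
/-- Hoeffding's lemma for the uniform distribution on a finite list of reals. -/
theorem sum_exp_sub_mean_le {n : ℕ} (hn : 0 < n) {a b : ℝ} (x : Fin n → ℝ)
    (hx : ∀ j, x j ∈ Set.Icc a b) (t : ℝ) :
    ∑ j, Real.exp (t * (x j - (∑ i, x i) / n)) ≤
      n * Real.exp (t ^ 2 * (b - a) ^ 2 / 8) := by
  have : NeZero n := ⟨hn.ne'⟩
  have hmgf := (hasSubgaussianMGF_of_mem_Icc
    (μ := (PMF.uniformOfFintype (Fin n)).toMeasure) (X := x)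
    (measurable_of_finite x).aemeasurable (Filter.Eventually.of_forall hx)).mgf_le t
  have hn' : (0 : ℝ) < n := by exact_mod_cast hn
  have hmean : ∫ j, x j ∂(PMF.uniformOfFintype (Fin n)).toMeasure = (∑ i, x i) / n := by
    simp [PMF.integral_eq_sum, ← Finset.mul_sum, div_eq_inv_mul]
  rw [hmean, mgf, PMF.integral_eq_sum] at hmgf
  simp only [PMF.uniformOfFintype_apply, Fintype.card_fin, ENNReal.toReal_inv,
    ENNReal.toReal_natCast, smul_eq_mul, ← Finset.mul_sum] at hmgf
  rw [inv_mul_le_iff₀ hn'] at hmgf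
  have hexponent : t ^ 2 * (b - a) ^ 2 / 8 =
      (((‖b - a‖₊ / 2) ^ 2 : NNReal) : ℝ) * t ^ 2 / 2 := by
    push_cast
    rw [div_pow, Real.norm_eq_abs, sq_abs]
    ring
  rwa [hexponent]

/-- The centred partial sum of the first `m` draws along the permutation `σ`. -/
noncomputable def centeredSum {n : ℕ} (m : ℕ) (x : Fin n → ℝ) (σ : Equiv.Perm (Fin n)) : ℝ :=
  ∑ t ∈ Finset.univ.filter (fun t : Fin n => (t : ℕ) < m), (x (σ t) - (∑ i, x i) / n)

theorem sum_swap_zero_succ {n : ℕ} (x : Fin (n + 1) → ℝ) (p : Fin (n + 1)) :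
    ∑ i : Fin n, x (Equiv.swap 0 p i.succ) = ∑ i, x i - x p := by
  have h := Equiv.sum_comp (Equiv.swap 0 p) x
  rw [Fin.sum_univ_succ, Equiv.swap_apply_left] at h
  linarith

theorem centeredSum_decomposeFin {n m : ℕ} (hn : 0 < n) (hm : m ≤ n) (x : Fin (n + 1) → ℝ)
    (p : Fin (n + 1)) (e : Equiv.Perm (Fin n)) :
    centeredSum (m + 1) x (Equiv.Perm.decomposeFin.symm (p, e)) =
      ((n : ℝ) - m) / n * (x p - (∑ i, x i) / (n + 1 : ℕ)) +
        centeredSum m (fun i => x (Equiv.swap 0 p i.succ)) e := by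
  have hn' : (n : ℝ) ≠ 0 := by exact_mod_cast hn.ne'
  have hn1 : (n : ℝ) + 1 ≠ 0 := by positivity
  unfold centeredSum
  rw [Finset.sum_filter, Fin.sum_univ_succ, sum_swap_zero_succ]
  simp only [Fin.val_zero, Nat.zero_lt_succ, if_true, Fin.val_succ, Nat.add_lt_add_iff_right,
    Equiv.Perm.decomposeFin_symm_apply_zero, Equiv.Perm.decomposeFin_symm_apply_succ,
    ← Finset.sum_filter, Finset.sum_sub_distrib, Finset.sum_const, Fin.card_filter_val_lt,
    min_eq_right hm, nsmul_eq_mul, Nat.cast_add, Nat.cast_one]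
  field_simp
  ring

/-- Serfling's bound for the moment generating function of a sample without replacement. -/
theorem sum_exp_centeredSum_le {a b : ℝ} (s : ℝ) {n m : ℕ} (hm : m ≤ n) (x : Fin n → ℝ)
    (hx : ∀ j, x j ∈ Set.Icc a b) :
    ∑ σ, Real.exp (s * centeredSum m x σ) ≤
      n.factorial * Real.exp (s ^ 2 * (b - a) ^ 2 / 8 * (m * (n - m + 1) / n)) := by
  induction n generalizing m with
  | zero =>
    obtain rfl : m = 0 := by omega
    simp [centeredSum]
  | succ n ih =>
    rcases m with _ | m
    · simp [centeredSum, Fintype.card_perm]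
    have hmn : m ≤ n := by omega
    rcases Nat.eq_zero_or_pos n with rfl | hn
    · obtain rfl : m = 0 := by omega
      simp [centeredSum]
      positivity
    have hn' : (0 : ℝ) < n := by exact_mod_cast hn
    have hmn' : (m : ℝ) ≤ n := by exact_mod_cast hmn
    set c : ℝ := s * (((n : ℝ) - m) / n) with hc
    set v : ℝ := s ^ 2 * (b - a) ^ 2 / 8 * (m * (n - m + 1) / n) with hv
    have hvariance : c ^ 2 * (b - a) ^ 2 / 8 + v ≤ s ^ 2 * (b - a) ^ 2 / 8 *
        ((m + 1 : ℕ) * ((n + 1 : ℕ) - (m + 1 : ℕ) + 1) / (n + 1 : ℕ)) := by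
      have hstep : (((n : ℝ) - m) / n) ^ 2 + m * (n - m + 1) / n ≤
          (m + 1 : ℕ) * ((n + 1 : ℕ) - (m + 1 : ℕ) + 1) / (n + 1 : ℕ) := by
        rw [← sub_nonneg]
        have : ((m + 1 : ℕ) * ((n + 1 : ℕ) - (m + 1 : ℕ) + 1) / (n + 1 : ℕ) : ℝ) -
            ((((n : ℝ) - m) / n) ^ 2 + m * (n - m + 1) / n) =
            ((n : ℝ) - m) * m / (n ^ 2 * (n + 1)) := by
          push_cast
          field_simp
          ring
        rw [this]
        have := sub_nonneg.2 hmn'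
        positivity
      calc c ^ 2 * (b - a) ^ 2 / 8 + v
          = s ^ 2 * (b - a) ^ 2 / 8 *
              ((((n : ℝ) - m) / n) ^ 2 + m * (n - m + 1) / n) := by rw [hc, hv]; ring
        _ ≤ _ := mul_le_mul_of_nonneg_left hstep (by positivity)
    calc ∑ σ, Real.exp (s * centeredSum (m + 1) x σ)
        = ∑ p, Real.exp (c * (x p - (∑ i, x i) / (n + 1 : ℕ))) *
            ∑ e, Real.exp (s * centeredSum m (fun i => x (Equiv.swap 0 p i.succ)) e) := by
          rw [← Equiv.sum_comp Equiv.Perm.decomposeFin.symm, Fintype.sum_prod_type]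
          refine Finset.sum_congr rfl fun p _ => ?_
          rw [Finset.mul_sum]
          refine Finset.sum_congr rfl fun e _ => ?_
          rw [centeredSum_decomposeFin hn hmn, ← Real.exp_add]
          congr 1
          rw [hc]
          ring
      _ ≤ ∑ p, Real.exp (c * (x p - (∑ i, x i) / (n + 1 : ℕ))) *
            (n.factorial * Real.exp v) := by
          gcongr with p
          exact ih hmn _ fun i => hx _
      _ ≤ ((n + 1 : ℕ) * Real.exp (c ^ 2 * (b - a) ^ 2 / 8)) *
            (n.factorial * Real.exp v) := by
          rw [← Finset.sum_mul]
          gcongr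
          exact sum_exp_sub_mean_le n.succ_pos x hx c
      _ = (n + 1).factorial * Real.exp (c ^ 2 * (b - a) ^ 2 / 8 + v) := by
          rw [Real.exp_add, Nat.factorial_succ]
          push_cast
          ring
      _ ≤ _ := by gcongr

theorem centeredSum_rev {n m : ℕ} (hm : m ≤ n) (x : Fin n → ℝ) (σ : Equiv.Perm (Fin n)) :
    centeredSum (n - m) x (Fin.revPerm.trans σ) = -centeredSum m x σ := by
  rcases Nat.eq_zero_or_pos n with rfl | hn
  · simp [centeredSum]
  have hn' : (n : ℝ) ≠ 0 := by exact_mod_cast hn.ne'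
  have hrev : centeredSum (n - m) x (Fin.revPerm.trans σ) =
      ∑ t ∈ Finset.univ.filter (fun t : Fin n => ¬ (t : ℕ) < m),
        (x (σ t) - (∑ i, x i) / n) := by
    unfold centeredSum
    rw [Finset.sum_filter, Finset.sum_filter, ← Equiv.sum_comp Fin.revPerm]
    refine Finset.sum_congr rfl fun t _ => ?_
    have : n - (t + 1 : ℕ) < n - m ↔ ¬ (t : ℕ) < m := by omega
    simp [Fin.val_rev, this]
  have htotal : ∑ t, (x (σ t) - (∑ i, x i) / n) = 0 := by
    rw [Finset.sum_sub_distrib, Equiv.sum_comp σ x]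
    simp
    field_simp
    ring
  rw [hrev, eq_neg_iff_add_eq_zero, add_comm]
  exact (Finset.sum_filter_add_sum_filter_not _ _ _).trans htotal

/-- Serfling's bound applied to the draws that were left out of the sample. -/
theorem sum_exp_centeredSum_le_compl {a b : ℝ} (s : ℝ) {n m : ℕ} (hm : m ≤ n) (x : Fin n → ℝ)
    (hx : ∀ j, x j ∈ Set.Icc a b) :
    ∑ σ, Real.exp (s * centeredSum m x σ) ≤
      n.factorial * Real.exp (s ^ 2 * (b - a) ^ 2 / 8 * ((n - m) * (m + 1) / n)) := by
  have h := sum_exp_centeredSum_le (-s) (Nat.sub_le n m) x hx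
  have hbij : Function.Bijective fun σ : Equiv.Perm (Fin n) => Fin.revPerm.trans σ :=
    Group.mulRight_bijective (G := Equiv.Perm (Fin n)) Fin.revPerm
  rw [← hbij.sum_comp fun σ => Real.exp (-s * centeredSum (n - m) x σ)] at h
  simpa [centeredSum_rev hm, Nat.cast_sub hm] using h

/-- Chernoff's bound for a finite family with a Gaussian moment generating function estimate,
in complementary form. -/
theorem one_sub_le_card_div_of_sum_exp_le {ι : Type*} [Fintype ι] [Nonempty ι] (T : ι → ℝ)
    {r w δ : ℝ} (hr : 0 < r) (hδ0 : 0 < δ) (hδ1 : δ < 1)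
    (hT : ∀ s, ∑ i, Real.exp (s * T i) ≤ Fintype.card ι * Real.exp (s ^ 2 * w))
    (hw : Real.log (1 / δ) * (4 * w) ≤ r ^ 2) :
    1 - δ ≤ (Nat.card {i // T i ≤ r} : ℝ) / (Nat.card ι : ℝ) := by
  classical
  set L := Real.log (1 / δ) with hL
  have hLpos : 0 < L := Real.log_pos (by rw [lt_div_iff₀ hδ0]; linarith)
  have hexpL : Real.exp (-L) = δ := by
    rw [hL, one_div, Real.log_inv, neg_neg, Real.exp_log hδ0]
  set s := 2 * L / r with hs
  have hspos : 0 < s := by positivity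
  have hcard : (0 : ℝ) < Fintype.card ι := by exact_mod_cast Fintype.card_pos
  have hsr : s * r = 2 * L := by rw [hs]; field_simp
  have hsw : s ^ 2 * w ≤ L := by
    have : s ^ 2 * w = L * (L * (4 * w)) / r ^ 2 := by rw [hs]; ring
    rw [this, div_le_iff₀ (by positivity)]
    exact mul_le_mul_of_nonneg_left hw hLpos.le
  have hmarkov : ((Finset.univ.filter fun i => ¬ T i ≤ r).card : ℝ) * Real.exp (s * r) ≤
      Fintype.card ι * Real.exp (s ^ 2 * w) := by
    refine le_trans ?_ (hT s)
    rw [← nsmul_eq_mul]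
    refine (Finset.card_nsmul_le_sum _ (fun i => Real.exp (s * T i)) _ fun i hi => ?_).trans
      (Finset.sum_le_univ_sum_of_nonneg fun i => (Real.exp_pos _).le)
    have : r < T i := by simpa using hi
    gcongr
  have htail : ((Finset.univ.filter fun i => ¬ T i ≤ r).card : ℝ) ≤ Fintype.card ι * δ := by
    rw [← le_div_iff₀ (Real.exp_pos _), mul_div_assoc, ← Real.exp_sub] at hmarkov
    refine hmarkov.trans ?_
    rw [← hexpL]
    gcongr
    linarith
  have hsplit : ((Finset.univ.filter fun i => T i ≤ r).card : ℝ) +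
      (Finset.univ.filter fun i => ¬ T i ≤ r).card = Fintype.card ι := by
    exact_mod_cast Finset.card_filter_add_card_filter_not (s := Finset.univ) fun i => T i ≤ r
  rw [Nat.card_eq_fintype_card, Nat.card_eq_fintype_card, Fintype.card_subtype,
    le_div_iff₀ hcard]
  linarith


/-- Sample-size version of the without-replacement concentration bound: if
`m ≥ min{(u+1)/(1+u/N), (u+u/N)/(1+u/N)}` with `u = (log(1/δ)/2)·(b−a)²/ε²`,
then `X̄_m − μ ≤ ε` with probability at least `1 − δ`. -/
theorem stmt2 (N : ℕ) (hN : 1 < N) (a b : ℝ) (hab : a < b)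
    (x : Fin N → ℝ) (hx : ∀ j, a ≤ x j ∧ x j ≤ b)
    (ε δ : ℝ) (hε0 : 0 < ε) (hε1 : ε < 1) (hδ0 : 0 < δ) (hδ1 : δ < 1)
    (u : ℝ) (hu : u = Real.log (1 / δ) / 2 * ((b - a) ^ 2 / ε ^ 2))
    (m : ℕ) (hm1 : 1 ≤ m) (hmN : m ≤ N)
    (hm : min ((u + 1) / (1 + u / (N : ℝ))) ((u + u / (N : ℝ)) / (1 + u / (N : ℝ))) ≤ (m : ℝ)) :
    1 - δ ≤
      (Nat.card {σ : Equiv.Perm (Fin N) //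
          (1 / (m : ℝ)) * (∑ t ∈ Finset.univ.filter (fun t : Fin N => (t : ℕ) < m), x (σ t))
              - (1 / (N : ℝ)) * ∑ j, x j ≤ ε} : ℝ)
        / (Nat.card (Equiv.Perm (Fin N)) : ℝ) := by
  have hm0 : (0 : ℝ) < m := by exact_mod_cast hm1
  have hN0 : (0 : ℝ) < N := by exact_mod_cast (zero_lt_one.trans hN)
  have hmN' : (m : ℝ) ≤ N := by exact_mod_cast hmN
  have hL : 0 < Real.log (1 / δ) := Real.log_pos (by rw [lt_div_iff₀ hδ0]; linarith)
  have hba : 0 < b - a := sub_pos.2 hab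
  have hu0 : 0 < u := by rw [hu]; positivity
  have hevent : ∀ σ : Equiv.Perm (Fin N),
      (1 / (m : ℝ)) * (∑ t ∈ Finset.univ.filter (fun t : Fin N => (t : ℕ) < m), x (σ t))
        - (1 / (N : ℝ)) * ∑ j, x j ≤ ε ↔ centeredSum m x σ ≤ m * ε := by
    intro σ
    rw [centeredSum, Finset.sum_sub_distrib, Finset.sum_const, Fin.card_filter_val_lt,
      min_eq_right hmN, nsmul_eq_mul, ← mul_le_mul_iff_right₀ hm0]
    apply iff_of_eq
    congr 1
    field_simp
  simp only [hevent]
  have hchernoff : ∀ V : ℝ, u * V ≤ m ^ 2 →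
      (∀ s, ∑ σ, Real.exp (s * centeredSum m x σ) ≤
        N.factorial * Real.exp (s ^ 2 * (b - a) ^ 2 / 8 * V)) →
      1 - δ ≤ (Nat.card {σ : Equiv.Perm (Fin N) // centeredSum m x σ ≤ m * ε} : ℝ)
        / (Nat.card (Equiv.Perm (Fin N)) : ℝ) := by
    intro V hV hmgf
    refine one_sub_le_card_div_of_sum_exp_le (w := (b - a) ^ 2 / 8 * V) _ (by positivity)
      hδ0 hδ1 (fun s => ?_) ?_
    · rw [Fintype.card_perm, Fintype.card_fin]
      convert hmgf s using 3
      ring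
    · have : Real.log (1 / δ) * (4 * ((b - a) ^ 2 / 8 * V)) = u * V * ε ^ 2 := by
        rw [hu]
        field_simp
        ring
      rw [this, mul_pow]
      gcongr
  have hden : 0 < 1 + u / (N : ℝ) := by positivity
  rcases min_le_iff.1 hm with h | h
  · refine hchernoff _ ?_ fun s => sum_exp_centeredSum_le_compl s hmN x hx
    rw [div_le_iff₀ hden] at h
    have hle : u * ((N - m) / N) ≤ m - 1 := by
      have : u * ((N - m) / N) = u - m * (u / N) := by field_simp
      linarith
    calc u * ((N - m) * (m + 1) / N) = u * ((N - m) / N) * (m + 1) := by ring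
      _ ≤ (m - 1) * (m + 1) := by gcongr
      _ ≤ (m : ℝ) ^ 2 := by linarith
  · refine hchernoff _ ?_ fun s => sum_exp_centeredSum_le s hmN x hx
    rw [div_le_iff₀ hden] at h
    have hle : u * ((N - m + 1) / N) ≤ m := by
      have : u * ((N - m + 1) / N) = u + u / N - m * (u / N) := by field_simp; ring
      linarith
    calc u * (m * (N - m + 1) / N) = u * ((N - m + 1) / N) * m := by ring
      _ ≤ m * m := by gcongr
      _ = (m : ℝ) ^ 2 := by ring
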